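/- Let R be a term rewriting system and G a finite E-graph. If EqSat(R, G) is finite, then equality saturation converges in a finite number of steps: the sequence ICO_R^(i)(G) is eventually constant up to isomorphism and reaches EqSat(R, G) after finitely many iterations. -/

import Mathlib

set_option autoImplicit false

/-! ## Terms over a signature -/

inductive Tm (F : Type) (ar : F → ℕ) (V : Type) : Type where
  | var : V → Tm F ar V
  | node : (f : F) → (Fin (ar f) → Tm F ar V) → Tm F ar V

namespace Tm

variable {F : Type} {ar : F → ℕ} {V W : Type}

/-- Apply a renaming of variables/states. -/
def map (σ : V → W) : Tm F ar V → Tm F ar W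
  | .var v => .var (σ v)
  | .node f ts => .node f fun i => (ts i).map σ

/-- Apply a substitution. -/
def subst (σ : V → Tm F ar W) : Tm F ar V → Tm F ar W
  | .var v => σ v
  | .node f ts => .node f fun i => (ts i).subst σ

/-- The set of variables occurring in a pattern. -/
def vars : Tm F ar V → Set V
  | .var v => {v}
  | .node _ ts => ⋃ i, (ts i).vars

end Tm

/-- Ground terms: terms with no variables. -/
abbrev GTm (F : Type) (ar : F → ℕ) : Type := Tm F ar Empty

/-- A ground term viewed as a term over `Σ ∪ V`. -/
def GTm.embed {F : Type} {ar : F → ℕ} {V : Type} (t : GTm F ar) : Tm F ar V :=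
  Tm.map (fun e => e.elim) t

/-- The (reflexive) subterm relation. -/
inductive Subterm {F : Type} {ar : F → ℕ} {V : Type} : Tm F ar V → Tm F ar V → Prop where
  | refl (t : Tm F ar V) : Subterm t t
  | node {u : Tm F ar V} {f : F} {ts : Fin (ar f) → Tm F ar V} (i : Fin (ar f)) :
      Subterm u (ts i) → Subterm u (.node f ts)

theorem Subterm.trans' {F : Type} {ar : F → ℕ} {V : Type} {a b c : Tm F ar V}
    (h1 : Subterm a b) (h2 : Subterm b c) : Subterm a c := by
  induction h2 with
  | refl => exact h1
  | node i _ ih => exact Subterm.node i ih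

theorem Subterm.child {F : Type} {ar : F → ℕ} {V : Type} {f : F}
    {ts : Fin (ar f) → Tm F ar V} {c : Tm F ar V} (i : Fin (ar f))
    (h : Subterm (.node f ts) c) : Subterm (ts i) c :=
  Subterm.trans' (Subterm.node i (Subterm.refl _)) h

/-! ## Tree automata and E-graphs -/

/-- A (bottom-up, possibly infinite) tree automaton: a set of states together with
transitions `f(q₁,…,qₖ) → q`. -/
structure Automaton (F : Type) (ar : F → ℕ) : Type 1 where
  Q : Type
  trans : (f : F) → Set ((Fin (ar f) → Q) × Q)

/-- `Accepts A t q` formalizes `t →*_A q`: the term `t ∈ T(Σ ∪ Q)` rewrites to the state `q`. -/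
inductive Accepts {F : Type} {ar : F → ℕ} (A : Automaton F ar) : Tm F ar A.Q → A.Q → Prop where
  | var (q : A.Q) : Accepts A (.var q) q
  | node {f : F} {ts : Fin (ar f) → Tm F ar A.Q} {qs : Fin (ar f) → A.Q} {q : A.Q} :
      (∀ i, Accepts A (ts i) (qs i)) → (qs, q) ∈ A.trans f → Accepts A (.node f ts) q

/-- A ground term `t ∈ T(Σ)` is accepted by the state `q`, i.e. `t →*_A q`. -/
def Automaton.AcceptsG {F : Type} {ar : F → ℕ} (A : Automaton F ar) (t : GTm F ar) (q : A.Q) : Prop :=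
  Accepts A (GTm.embed t) q

/-- Deterministic: every ground term is accepted by at most one state. -/
def Automaton.Deterministic {F : Type} {ar : F → ℕ} (A : Automaton F ar) : Prop :=
  ∀ (t : GTm F ar) (q1 q2 : A.Q), A.AcceptsG t q1 → A.AcceptsG t q2 → q1 = q2

/-- Reachable: every state accepts some ground term. -/
def Automaton.ReachableA {F : Type} {ar : F → ℕ} (A : Automaton F ar) : Prop :=
  ∀ q : A.Q, ∃ t : GTm F ar, A.AcceptsG t q

/-- An E-graph is a deterministic and reachable tree automaton. -/
structure EGraph (F : Type) (ar : F → ℕ) extends Automaton F ar where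
  det : toAutomaton.Deterministic
  reach : toAutomaton.ReachableA

/-- A homomorphism of tree automata: maps states to states, preserving all transitions. -/
structure AHom {F : Type} {ar : F → ℕ} (A B : Automaton F ar) : Type where
  toFun : A.Q → B.Q
  map_trans : ∀ (f : F) (qs : Fin (ar f) → A.Q) (q : A.Q),
    (qs, q) ∈ A.trans f → (fun i => toFun (qs i), toFun q) ∈ B.trans f

/-- `A ⊑ B` : there exists a homomorphism from `A` to `B`. -/
def ALe {F : Type} {ar : F → ℕ} (A B : Automaton F ar) : Prop := Nonempty (AHom A B)

def EGraph.Le {F : Type} {ar : F → ℕ} (G H : EGraph F ar) : Prop :=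
  ALe G.toAutomaton H.toAutomaton

/-- Isomorphism of E-graphs: mutually inverse homomorphisms. -/
def EGraph.Iso {F : Type} {ar : F → ℕ} (G H : EGraph F ar) : Prop :=
  ∃ (h : AHom G.toAutomaton H.toAutomaton) (h' : AHom H.toAutomaton G.toAutomaton),
    (∀ q, h'.toFun (h.toFun q) = q) ∧ (∀ q, h.toFun (h'.toFun q) = q)

/-- The partial congruence relation `≈_G` induced by an E-graph:
two ground terms are related iff some state accepts both. -/
def EGraph.eqv {F : Type} {ar : F → ℕ} (G : EGraph F ar) (t1 t2 : GTm F ar) : Prop :=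
  ∃ q : G.Q, G.toAutomaton.AcceptsG t1 q ∧ G.toAutomaton.AcceptsG t2 q

/-- A finite E-graph: finitely many states and transitions. -/
def EGraph.IsFinite {F : Type} {ar : F → ℕ} (G : EGraph F ar) : Prop :=
  Finite G.Q ∧ ∀ f : F, (G.trans f).Finite

/-! ## Partial congruence relations -/

/-- A partial congruence relation (PCR) on ground terms: a symmetric, transitive,
congruent and reachable binary relation. -/
structure IsPCR {F : Type} {ar : F → ℕ} (E : GTm F ar → GTm F ar → Prop) : Prop where
  symm : ∀ {t1 t2 : GTm F ar}, E t1 t2 → E t2 t1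
  trans : ∀ {t1 t2 t3 : GTm F ar}, E t1 t2 → E t2 t3 → E t1 t3
  congruent : ∀ (f : F) (s t : Fin (ar f) → GTm F ar),
    (∀ i, E (s i) (t i)) → E (.node f s) (.node f s) → E (.node f s) (.node f t)
  reachable : ∀ (f : F) (s : Fin (ar f) → GTm F ar),
    E (.node f s) (.node f s) → ∀ i, E (s i) (s i)

/-- The join of two PCRs: the smallest PCR containing both. -/
def joinPCR {F : Type} {ar : F → ℕ} (E1 E2 : GTm F ar → GTm F ar → Prop)
    (a b : GTm F ar) : Prop :=
  ∀ E : GTm F ar → GTm F ar → Prop, IsPCR E →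
    (∀ x y, E1 x y → E x y) → (∀ x y, E2 x y → E x y) → E a b

/-! ## Term rewriting systems -/

/-- A term rewriting system: a finite set of rules `lhs → rhs` between patterns
(terms with variables drawn from `ℕ`), with `Var(rhs) ⊆ Var(lhs)`. -/
structure TRS (F : Type) (ar : F → ℕ) where
  rules : Set (Tm F ar ℕ × Tm F ar ℕ)
  finite : rules.Finite
  var_cond : ∀ r ∈ rules, Tm.vars r.2 ⊆ Tm.vars r.1

/-- The ground rewrite relation `→_R` determined by a TRS. -/
inductive RWStep {F : Type} {ar : F → ℕ} (R : TRS F ar) : GTm F ar → GTm F ar → Prop where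
  | rule {l r : Tm F ar ℕ} (h : (l, r) ∈ R.rules) (σ : ℕ → GTm F ar) :
      RWStep R (l.subst σ) (r.subst σ)
  | congr {f : F} {ts : Fin (ar f) → GTm F ar} {i : Fin (ar f)} {u : GTm F ar} :
      RWStep R (ts i) u → RWStep R (.node f ts) (.node f (Function.update ts i u))

/-- `≈_R` : the reflexive-symmetric-transitive closure of `→_R`. -/
def TRSEqv {F : Type} {ar : F → ℕ} (R : TRS F ar) : GTm F ar → GTm F ar → Prop :=
  Relation.ReflTransGen fun a b => RWStep R a b ∨ RWStep R b a

/-! ## E-matching, insertion and congruence closure -/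

/-- An e-match of a rule in an E-graph: a substitution `σ` into E-classes and a root
E-class `c` with `lhs[σ] →*_G c`. -/
structure EMatch {F : Type} {ar : F → ℕ} (R : TRS F ar) (G : EGraph F ar) : Type where
  lhs : Tm F ar ℕ
  rhs : Tm F ar ℕ
  mem : (lhs, rhs) ∈ R.rules
  sub : ℕ → G.Q
  root : G.Q
  acc : Accepts G.toAutomaton (Tm.map sub lhs) root

/-- Fresh states of the flattenings added by the match/apply operator: one state per
(match, subterm of the instantiated right-hand side). -/
def MExtra {F : Type} {ar : F → ℕ} (R : TRS F ar) (G : EGraph F ar) : Type :=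
  { p : EMatch R G × Tm F ar G.Q // Subterm p.2 (Tm.map p.1.sub p.1.rhs) }

open Classical in
/-- The state of the flattening `FL(rhs[σ] →* c)` associated to a subterm `u` of `rhs[σ]`:
states at the leaves are kept, the root is mapped to `c = root`, and all other subterms
get a fresh state. -/
noncomputable def stateOf {F : Type} {ar : F → ℕ} (R : TRS F ar) (G : EGraph F ar)
    (m : EMatch R G) :
    (u : Tm F ar G.Q) → Subterm u (Tm.map m.sub m.rhs) → G.Q ⊕ MExtra R G
  | .var q, _ => Sum.inl q
  | .node f ts, h =>
      if Tm.node f ts = Tm.map m.sub m.rhs then Sum.inl m.root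
      else Sum.inr ⟨(m, Tm.node f ts), h⟩

/-- The match/apply operator `T_R`: the (possibly non-deterministic) tree automaton
obtained from `G` by inserting the flattening `FL(rhs[σ] →* c)` for every e-match. -/
noncomputable def TRaut {F : Type} {ar : F → ℕ} (R : TRS F ar) (G : EGraph F ar) :
    Automaton F ar where
  Q := G.Q ⊕ MExtra R G
  trans f := { p |
    (∃ (qs : Fin (ar f) → G.Q) (q : G.Q), (qs, q) ∈ G.trans f ∧
      p = (fun i => Sum.inl (qs i), Sum.inl q)) ∨
    (∃ (m : EMatch R G) (ts : Fin (ar f) → Tm F ar G.Q)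
        (h : Subterm (.node f ts) (Tm.map m.sub m.rhs)),
      p = (fun i => stateOf R G m (ts i) (Subterm.child i h),
           stateOf R G m (.node f ts) h)) }

/-- `G` is the congruence closure (rebuilding) of the automaton `A`: the ⊑-least E-graph
above `A`. -/
def IsCC {F : Type} {ar : F → ℕ} (A : Automaton F ar) (G : EGraph F ar) : Prop :=
  ALe A G.toAutomaton ∧ ∀ H : EGraph F ar, ALe A H.toAutomaton → EGraph.Le G H

/-- `H` is (up to isomorphism) the result of the immediate consequence operator
`ICO_R = CC ∘ T_R` applied to `G`. -/
def IsICO {F : Type} {ar : F → ℕ} (R : TRS F ar) (G H : EGraph F ar) : Prop :=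
  IsCC (TRaut R G) H

/-- `S` is the sequence of iterates `S i = ICO_R^(i)(G)`. -/
def IterSeq {F : Type} {ar : F → ℕ} (R : TRS F ar) (G : EGraph F ar)
    (S : ℕ → EGraph F ar) : Prop :=
  S 0 = G ∧ ∀ i, IsICO R (S i) (S (i + 1))

/-- `H` is a least upper bound of the sequence `S` of E-graphs. -/
def IsLUBseq {F : Type} {ar : F → ℕ} (S : ℕ → EGraph F ar) (H : EGraph F ar) : Prop :=
  (∀ i, (S i).Le H) ∧ ∀ H' : EGraph F ar, (∀ i, (S i).Le H') → H.Le H'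

/-- `H` is a least upper bound of the family `Gs` of E-graphs. -/
def IsLUBfam {F : Type} {ar : F → ℕ} {I : Type} (Gs : I → EGraph F ar)
    (H : EGraph F ar) : Prop :=
  (∀ i, (Gs i).Le H) ∧ ∀ H' : EGraph F ar, (∀ i, (Gs i).Le H') → H.Le H'

/-- `H = EqSat(R, G) = ⊔_{i ≥ 0} ICO_R^(i)(G)`. -/
def IsEqSat {F : Type} {ar : F → ℕ} (R : TRS F ar) (G H : EGraph F ar) : Prop :=
  ∃ S : ℕ → EGraph F ar, IterSeq R G S ∧ IsLUBseq S H

/-- `H` is a model of the TRS `R`. -/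
def ModelTRS {F : Type} {ar : F → ℕ} (R : TRS F ar) (H : EGraph F ar) : Prop :=
  ∀ r ∈ R.rules, ∀ (σ : ℕ → H.Q) (c : H.Q),
    Accepts H.toAutomaton (Tm.map σ r.1) c → Accepts H.toAutomaton (Tm.map σ r.2) c

/-- `H` is a model of the pair `(R, G)`. -/
def IsModelOf {F : Type} {ar : F → ℕ} (R : TRS F ar) (G H : EGraph F ar) : Prop :=
  G.Le H ∧ ModelTRS R H

/-- `H` is a universal model of the pair `(R, G)`. -/
def IsUniversalModel {F : Type} {ar : F → ℕ} (R : TRS F ar) (G H : EGraph F ar) : Prop :=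
  IsModelOf R G H ∧ ∀ H' : EGraph F ar, IsModelOf R G H' → H.Le H'

/-- `G` is (up to isomorphism) the flattening `FL(t →* c)` of a ground term `t`:
the ⊑-least E-graph representing `t`. -/
def IsTermEG {F : Type} {ar : F → ℕ} (t : GTm F ar) (G : EGraph F ar) : Prop :=
  (∃ c, G.toAutomaton.AcceptsG t c) ∧
  ∀ H : EGraph F ar, (∃ c, H.toAutomaton.AcceptsG t c) → G.Le H

/-- Equality saturation terminates on `(R, G)`: the sequence of iterates
`ICO_R^(i)(G)` is eventually constant up to isomorphism. -/
def EqSatTerminates {F : Type} {ar : F → ℕ} (R : TRS F ar) (G : EGraph F ar) : Prop :=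
  ∃ S : ℕ → EGraph F ar, IterSeq R G S ∧ ∃ n, ∀ m, n ≤ m → (S m).Iso (S n)

namespace Automaton

variable {F : Type} {ar : F → ℕ} {A B : Automaton F ar}

theorem acceptsG_node_iff {f : F} {ts : Fin (ar f) → GTm F ar} {q : A.Q} :
    A.AcceptsG (.node f ts) q ↔
      ∃ qs : Fin (ar f) → A.Q, (∀ i, A.AcceptsG (ts i) (qs i)) ∧ (qs, q) ∈ A.trans f := by
  constructor
  · intro h
    change Accepts A (.node f fun i => GTm.embed (ts i)) q at h
    cases h with
    | node h hq => exact ⟨_, h, hq⟩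
  · rintro ⟨qs, h, hq⟩
    exact Accepts.node h hq

theorem AcceptsG.map (h : AHom A B) (t : GTm F ar) :
    ∀ {q : A.Q}, A.AcceptsG t q → B.AcceptsG t (h.toFun q) := by
  induction t with
  | var v => exact v.elim
  | node f ts ih =>
    intro q hq
    obtain ⟨qs, hqs, hf⟩ := acceptsG_node_iff.1 hq
    exact acceptsG_node_iff.2 ⟨_, fun i => ih i (hqs i), h.map_trans f qs q hf⟩

end Automaton

open Automaton

theorem ALe.trans {F : Type} {ar : F → ℕ} {A B C : Automaton F ar}
    (hAB : ALe A B) (hBC : ALe B C) : ALe A C := by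
  obtain ⟨g⟩ := hAB
  obtain ⟨h⟩ := hBC
  exact ⟨⟨h.toFun ∘ g.toFun, fun f qs q hq => h.map_trans f _ _ (g.map_trans f qs q hq)⟩⟩

/-- The automaton whose states are the classes of a relation `E` on ground terms and whose
transitions are those realized by representatives of the classes. -/
def classAutomaton {F : Type} {ar : F → ℕ} (E : GTm F ar → GTm F ar → Prop) :
    Automaton F ar where
  Q := {X : Set (GTm F ar) // ∃ t, E t t ∧ X = {s | E t s}}
  trans f := {p | ∃ ts : Fin (ar f) → GTm F ar,
    (∀ i, ts i ∈ (p.1 i).1) ∧ Tm.node f ts ∈ p.2.1}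

namespace IsPCR

variable {F : Type} {ar : F → ℕ} {E : GTm F ar → GTm F ar → Prop}

theorem rel_of_mem (hE : IsPCR E) {q : (classAutomaton E).Q} {s t : GTm F ar}
    (hs : s ∈ q.1) (ht : t ∈ q.1) : E s t := by
  obtain ⟨u, -, hu⟩ := q.2
  rw [hu] at hs ht
  exact hE.trans (hE.symm hs) ht

theorem mem_of_rel (hE : IsPCR E) {q : (classAutomaton E).Q} {s t : GTm F ar}
    (hs : s ∈ q.1) (hst : E s t) : t ∈ q.1 := by
  obtain ⟨u, -, hu⟩ := q.2
  rw [hu] at hs ⊢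
  exact hE.trans hs hst

theorem mem_of_acceptsG (hE : IsPCR E) (t : GTm F ar) :
    ∀ {q : (classAutomaton E).Q}, (classAutomaton E).AcceptsG t q → t ∈ q.1 := by
  induction t with
  | var v => exact v.elim
  | node f ts ih =>
    intro q hq
    obtain ⟨qs, hqs, us, hus, huq⟩ := acceptsG_node_iff.1 hq
    exact hE.mem_of_rel huq (hE.congruent f us ts
      (fun i => hE.rel_of_mem (hus i) (ih i (hqs i))) (hE.rel_of_mem huq huq))

theorem acceptsG_class (hE : IsPCR E) (t : GTm F ar) :
    ∀ ht : E t t, (classAutomaton E).AcceptsG t ⟨{s | E t s}, t, ht, rfl⟩ := by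
  induction t with
  | var v => exact v.elim
  | node f ts ih =>
    intro ht
    have hts := hE.reachable f ts ht
    exact acceptsG_node_iff.2 ⟨_, fun i => ih i (hts i), ts, hts, ht⟩

/-- The E-graph of the classes of a PCR. -/
def toEGraph (hE : IsPCR E) : EGraph F ar where
  toAutomaton := classAutomaton E
  det t q₁ q₂ h₁ h₂ := by
    have m₁ := hE.mem_of_acceptsG t h₁
    have m₂ := hE.mem_of_acceptsG t h₂
    exact Subtype.ext (Set.ext fun s =>
      ⟨fun h => hE.mem_of_rel m₂ (hE.rel_of_mem m₁ h),
        fun h => hE.mem_of_rel m₁ (hE.rel_of_mem m₂ h)⟩)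
  reach := by
    rintro ⟨_, t, ht, rfl⟩
    exact ⟨t, hE.acceptsG_class t ht⟩

theorem le_toEGraph (hE : IsPCR E) {G : EGraph F ar} (hG : ∀ s t, G.eqv s t → E s t) :
    G.Le hE.toEGraph := by
  choose r hr using G.reach
  refine ⟨⟨fun q => ⟨{s | E (r q) s}, r q, hG _ _ ⟨q, hr q, hr q⟩, rfl⟩, ?_⟩⟩
  intro f qs q hq
  exact ⟨fun i => r (qs i), fun i => hG _ _ ⟨qs i, hr _, hr _⟩,
    hG _ _ ⟨q, hr q, acceptsG_node_iff.2 ⟨qs, fun i => hr _, hq⟩⟩⟩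

theorem of_eqv_toEGraph (hE : IsPCR E) {s t : GTm F ar} (h : hE.toEGraph.eqv s t) : E s t := by
  obtain ⟨q, hs, ht⟩ := h
  exact hE.rel_of_mem (hE.mem_of_acceptsG s hs) (hE.mem_of_acceptsG t ht)

end IsPCR

namespace EGraph

variable {F : Type} {ar : F → ℕ} {G H : EGraph F ar}

theorem Le.antisymm (hGH : G.Le H) (hHG : H.Le G) : G.Iso H := by
  obtain ⟨g⟩ := hGH
  obtain ⟨h⟩ := hHG
  refine ⟨g, h, fun q => ?_, fun q => ?_⟩
  · obtain ⟨t, ht⟩ := G.reach q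
    exact G.det t _ _ ((ht.map g).map h) ht
  · obtain ⟨t, ht⟩ := H.reach q
    exact H.det t _ _ ((ht.map h).map g) ht

theorem eqv.mono {s t : GTm F ar} (hGH : G.Le H) (h : G.eqv s t) : H.eqv s t := by
  obtain ⟨g⟩ := hGH
  obtain ⟨q, hs, ht⟩ := h
  exact ⟨g.toFun q, hs.map g, ht.map g⟩

theorem isPCR_eqv (G : EGraph F ar) : IsPCR G.eqv where
  symm := fun ⟨q, h₁, h₂⟩ => ⟨q, h₂, h₁⟩
  trans := by
    rintro t₁ t₂ t₃ ⟨p, h₁, h₂⟩ ⟨q, h₂', h₃⟩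
    obtain rfl := G.det t₂ p q h₂ h₂'
    exact ⟨p, h₁, h₃⟩
  congruent := by
    rintro f s t hst ⟨q, hq, -⟩
    obtain ⟨qs, hqs, hf⟩ := acceptsG_node_iff.1 hq
    refine ⟨q, hq, acceptsG_node_iff.2 ⟨qs, fun i => ?_, hf⟩⟩
    obtain ⟨p, hs, ht⟩ := hst i
    exact G.det (s i) p (qs i) hs (hqs i) ▸ ht
  reachable := by
    rintro f s ⟨q, hq, -⟩ i
    obtain ⟨qs, hqs, -⟩ := acceptsG_node_iff.1 hq
    exact ⟨qs i, hqs i, hqs i⟩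

end EGraph

/-- The union of the PCRs of an increasing sequence of E-graphs is a PCR. -/
theorem isPCR_exists_eqv {F : Type} {ar : F → ℕ} {S : ℕ → EGraph F ar}
    (hS : ∀ m n, m ≤ n → (S m).Le (S n)) : IsPCR fun s t => ∃ n, (S n).eqv s t where
  symm := fun ⟨n, h⟩ => ⟨n, (S n).isPCR_eqv.symm h⟩
  trans := by
    rintro t₁ t₂ t₃ ⟨m, h₁⟩ ⟨n, h₂⟩
    exact ⟨max m n, (S _).isPCR_eqv.trans (h₁.mono (hS _ _ (le_max_left m n)))
      (h₂.mono (hS _ _ (le_max_right m n)))⟩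
  congruent := by
    rintro f s t hst ⟨m, h⟩
    choose k hk using hst
    obtain ⟨N, hN⟩ := Finite.exists_le k
    exact ⟨max m N, (S _).isPCR_eqv.congruent f s t
      (fun i => (hk i).mono (hS _ _ ((hN i).trans (le_max_right m N))))
      (h.mono (hS _ _ (le_max_left m N)))⟩
  reachable := fun f s ⟨n, h⟩ i => ⟨n, (S n).isPCR_eqv.reachable f s h i⟩

/-- Terms identified by the least upper bound of an increasing sequence are identified at some
stage of the sequence. -/
theorem IsLUBseq.exists_eqv {F : Type} {ar : F → ℕ} {S : ℕ → EGraph F ar} {H : EGraph F ar}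
    (hH : IsLUBseq S H) (hS : ∀ m n, m ≤ n → (S m).Le (S n)) {s t : GTm F ar}
    (h : H.eqv s t) : ∃ n, (S n).eqv s t :=
  have hE := isPCR_exists_eqv hS
  hE.of_eqv_toEGraph (h.mono (hH.2 _ fun i => hE.le_toEGraph fun _ _ h => ⟨i, h⟩))

/-- A finite least upper bound of an increasing sequence lies below some stage. -/
theorem IsLUBseq.exists_le {F : Type} {ar : F → ℕ} [Finite F] {S : ℕ → EGraph F ar}
    {H : EGraph F ar} (hH : IsLUBseq S H) (hS : ∀ m n, m ≤ n → (S m).Le (S n))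
    (hfin : H.IsFinite) : ∃ n, H.Le (S n) := by
  have := hfin.1
  have := fun f => (hfin.2 f).to_subtype
  choose r hr using H.reach
  have hstate (q : H.Q) : ∃ n, (S n).eqv (r q) (r q) :=
    hH.exists_eqv hS ⟨q, hr q, hr q⟩
  have htrans (x : Σ f, H.trans f) :
      ∃ n, (S n).eqv (.node x.1 fun i => r (x.2.1.1 i)) (r x.2.1.2) :=
    hH.exists_eqv hS ⟨x.2.1.2, acceptsG_node_iff.2 ⟨x.2.1.1, fun i => hr _, x.2.2⟩, hr _⟩
  choose k hk using hstate
  choose l hl using htrans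
  obtain ⟨K, hK⟩ := Finite.exists_le k
  obtain ⟨L, hL⟩ := Finite.exists_le l
  refine ⟨max K L, ?_⟩
  choose g hg _ using fun q => (hk q).mono (hS _ _ ((hK q).trans (le_max_left K L)))
  refine ⟨⟨g, fun f qs q hq => ?_⟩⟩
  obtain ⟨p, hp, hpq⟩ := (hl ⟨f, (qs, q), hq⟩).mono (hS _ _ ((hL _).trans (le_max_right K L)))
  obtain ⟨ps, hps, hf⟩ := acceptsG_node_iff.1 hp
  obtain rfl := (S _).det _ _ _ hpq (hg q)
  have hgps : (fun i => g (qs i)) = ps := funext fun i => (S _).det _ _ _ (hg (qs i)) (hps i)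
  rwa [hgps]

theorem IsICO.le {F : Type} {ar : F → ℕ} {R : TRS F ar} {G H : EGraph F ar}
    (h : IsICO R G H) : G.Le H :=
  ALe.trans (B := TRaut R G) ⟨⟨Sum.inl, fun _ qs q hq => Or.inl ⟨qs, q, hq, rfl⟩⟩⟩ h.1

theorem IterSeq.le {F : Type} {ar : F → ℕ} {R : TRS F ar} {G : EGraph F ar}
    {S : ℕ → EGraph F ar} (hS : IterSeq R G S) (m n : ℕ) (hmn : m ≤ n) : (S m).Le (S n) := by
  induction n, hmn using Nat.le_induction with
  | base => exact ⟨⟨id, fun _ _ _ h => h⟩⟩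
  | succ n _ ih => exact ALe.trans ih (hS.2 n).le

/-- Finite convergence of EqSat: if `G` is a finite E-graph and `EqSat(R, G)` is finite,
then equality saturation converges in a finite number of steps: the sequence of iterates
`ICO_R^(i)(G)` is eventually constant up to isomorphism and reaches `EqSat(R, G)` after
finitely many iterations. -/
theorem eqsat_finite_convergence {F : Type} {ar : F → ℕ} [Finite F]
    (R : TRS F ar) (G : EGraph F ar) (hG : G.IsFinite)
    (S : ℕ → EGraph F ar) (hS : IterSeq R G S)
    (H : EGraph F ar) (hH : IsLUBseq S H) (hHfin : H.IsFinite) :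
    ∃ n, (∀ m, n ≤ m → (S m).Iso (S n)) ∧ (S n).Iso H := by
  obtain ⟨n, hn⟩ := hH.exists_le hS.le hHfin
  exact ⟨n, fun m hm => EGraph.Le.antisymm (ALe.trans (hH.1 m) hn) (hS.le n m hm),
    EGraph.Le.antisymm (hH.1 n) hn⟩
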